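/- arXiv:math/0009098 — 7 statements merged into one kernel-verified Lean document; each statement's English description precedes it below -/
import Mathlib

section
/- Let ν and ν^ε (ε>0) be non-identically-zero locally finite Borel measures on ℝ. If Condition 1 holds (every atom of ν is a limit of atoms of ν^ε) and ν^ε converges to ν vaguely as ε→0, then ν^ε converges to ν in the point process sense as ε→0. -/
open MeasureTheory Filter Topology Set

noncomputable section

/-- The set of atoms of a Borel measure on ℝ, viewed as the subset
`V(ν) = {(y, ν{y}) : ν{y} > 0}` of `ℝ × (0,∞)` (locations and weights). -/
def atomSet (ν : Measure ℝ) : Set (ℝ × ℝ) :=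
  {p | 0 < p.2 ∧ (ν {p.1}).toReal = p.2}

/-- Vague convergence `ν^ε →v ν` as `ε → 0⁺`: integrals of continuous functions
with compact support converge. -/
def VagueTo (νe : ℝ → Measure ℝ) (ν : Measure ℝ) : Prop :=
  ∀ f : ℝ → ℝ, Continuous f → HasCompactSupport f →
    Tendsto (fun ε => ∫ x, f x ∂(νe ε)) (𝓝[>] (0 : ℝ)) (𝓝 (∫ x, f x ∂ν))

/-- Point process convergence `ν^ε →pp ν` as `ε → 0⁺`: for every open set `U`
whose closure is a compact subset of `ℝ × (0,∞)` and whose boundary contains no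
point of `V(ν)`, the number of points of `V(ν^ε)` in `U` equals the number of
points of `V(ν)` in `U` for all sufficiently small `ε`. -/
def PPTo (νe : ℝ → Measure ℝ) (ν : Measure ℝ) : Prop :=
  ∀ U : Set (ℝ × ℝ), IsOpen U → IsCompact (closure U) →
    closure U ⊆ {p : ℝ × ℝ | 0 < p.2} →
    (∀ p ∈ frontier U, p ∉ atomSet ν) →
    ∀ᶠ ε in 𝓝[>] (0 : ℝ),
      (atomSet (νe ε) ∩ U).ncard = (atomSet ν ∩ U).ncard

/-- Condition 1: every atom of `ν` is a limit of atoms of `ν^ε` as `ε → 0⁺`. -/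
def Cond1 (νe : ℝ → Measure ℝ) (ν : Measure ℝ) : Prop :=
  ∀ p ∈ atomSet ν, ∃ q : ℝ → ℝ × ℝ,
    (∀ᶠ ε in 𝓝[>] (0 : ℝ), q ε ∈ atomSet (νe ε)) ∧
    Tendsto q (𝓝[>] (0 : ℝ)) (𝓝 p)

/-- Under vague convergence, the masses near a point are asymptotically at most the mass of
that point. -/
theorem VagueTo.exists_eventually_measureReal_ball_le {νe : ℝ → Measure ℝ} {ν : Measure ℝ}
    [IsLocallyFiniteMeasure ν] (hloc : ∀ ε > (0 : ℝ), IsLocallyFiniteMeasure (νe ε))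
    (hvague : VagueTo νe ν) (y : ℝ) {η : ℝ} (hη : 0 < η) :
    ∃ r > 0, ∀ᶠ ε in 𝓝[>] (0 : ℝ), (νe ε).real (Metric.ball y r) ≤ ν.real {y} + η := by
  have hfin : ν (Metric.cthickening 1 {y}) ≠ ⊤ := by
    rw [Metric.cthickening_singleton _ zero_le_one]
    exact (isCompact_closedBall y 1).measure_lt_top.ne
  have hlim : Tendsto (fun r => ν.real (Metric.cthickening r {y})) (𝓝 0) (𝓝 (ν.real {y})) :=
    (ENNReal.tendsto_toReal (isCompact_singleton (x := y)).measure_lt_top.ne).comp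
      (tendsto_measure_cthickening_of_isClosed ⟨1, one_pos, hfin⟩ isClosed_singleton)
  obtain ⟨R, hR, hball⟩ := Metric.eventually_nhds_iff.1
    (hlim.eventually_lt_const (lt_add_of_pos_right _ hη))
  have hmass : ν.real (Metric.closedBall y (R / 2)) < ν.real {y} + η := by
    rw [← Metric.cthickening_singleton y (half_pos hR).le]
    apply hball
    rw [Real.dist_eq, sub_zero, abs_of_pos (half_pos hR)]
    linarith
  let f : ContDiffBump y := ⟨R / 4, R / 2, by positivity, by linarith⟩
  have hint : ∫ x, f x ∂ν ≤ ν.real (Metric.closedBall y (R / 2)) := by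
    rw [← integral_indicator_one Metric.isClosed_closedBall.measurableSet]
    refine integral_mono (f.continuous.integrable_of_hasCompactSupport f.hasCompactSupport)
      ((integrable_indicator_iff Metric.isClosed_closedBall.measurableSet).2
        (integrableOn_const (isCompact_closedBall y _).measure_lt_top.ne)) fun x => ?_
    by_cases hx : x ∈ Metric.closedBall y (R / 2)
    · simpa [indicator_of_mem hx] using f.le_one
    · rw [indicator_of_notMem hx]
      exact (f.zero_of_le_dist (not_le.1 hx).le).le
  refine ⟨R / 4, by positivity, ?_⟩
  filter_upwards [(hvague f f.continuous f.hasCompactSupport).eventually_lt_const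
    (hint.trans_lt hmass), self_mem_nhdsWithin] with ε hε hpos
  have := hloc ε hpos
  refine le_trans ?_ hε.le
  rw [← integral_indicator_one Metric.isOpen_ball.measurableSet]
  refine integral_mono ((integrable_indicator_iff Metric.isOpen_ball.measurableSet).2
    (integrableOn_const (measure_ball_lt_top).ne))
    (f.continuous.integrable_of_hasCompactSupport f.hasCompactSupport) fun x => ?_
  by_cases hx : x ∈ Metric.ball y (R / 4)
  · rw [indicator_of_mem hx, f.one_of_mem_closedBall (Metric.ball_subset_closedBall hx)]
    rfl
  · rw [indicator_of_notMem hx]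
    exact f.nonneg

theorem measureReal_singleton_of_mem_atomSet {ν : Measure ℝ} {p : ℝ × ℝ} (hp : p ∈ atomSet ν) :
    ν.real {p.1} = p.2 := hp.2

theorem eq_of_mem_atomSet_of_fst_eq {ν : Measure ℝ} {p q : ℝ × ℝ} (hp : p ∈ atomSet ν)
    (hq : q ∈ atomSet ν) (h : p.1 = q.1) : p = q :=
  Prod.ext h (by rw [← hp.2, ← hq.2, h])

theorem snd_le_measureReal_of_mem_atomSet {ν : Measure ℝ} [IsLocallyFiniteMeasure ν]
    {p : ℝ × ℝ} (hp : p ∈ atomSet ν) {y r : ℝ} (hpr : p.1 ∈ Metric.ball y r) :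
    p.2 ≤ ν.real (Metric.ball y r) := by
  rw [← measureReal_singleton_of_mem_atomSet hp]
  exact measureReal_mono (singleton_subset_iff.2 hpr) measure_ball_lt_top.ne

theorem snd_add_snd_le_measureReal_of_mem_atomSet {ν : Measure ℝ} [IsLocallyFiniteMeasure ν]
    {p q : ℝ × ℝ} (hp : p ∈ atomSet ν) (hq : q ∈ atomSet ν) (hpq : p ≠ q) {y r : ℝ}
    (hpr : p.1 ∈ Metric.ball y r) (hqr : q.1 ∈ Metric.ball y r) :
    p.2 + q.2 ≤ ν.real (Metric.ball y r) := by
  have hne : p.1 ≠ q.1 := fun h => hpq (eq_of_mem_atomSet_of_fst_eq hp hq h)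
  rw [← measureReal_singleton_of_mem_atomSet hp, ← measureReal_singleton_of_mem_atomSet hq,
    ← measureReal_union (disjoint_singleton.2 hne) (measurableSet_singleton _)
      (isCompact_singleton (x := p.1)).measure_lt_top.ne
      (isCompact_singleton (x := q.1)).measure_lt_top.ne]
  exact measureReal_mono (union_subset (singleton_subset_iff.2 hpr) (singleton_subset_iff.2 hqr))
    measure_ball_lt_top.ne

/-- Near an atom of the vague limit, the only atoms of `νe ε` whose weight is bounded below are
those converging to it. -/
theorem VagueTo.exists_eventually_eq_of_tendsto {νe : ℝ → Measure ℝ} {ν : Measure ℝ}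
    [IsLocallyFiniteMeasure ν] (hloc : ∀ ε > (0 : ℝ), IsLocallyFiniteMeasure (νe ε))
    (hvague : VagueTo νe ν) {p : ℝ × ℝ} (hp : p ∈ atomSet ν) {q : ℝ → ℝ × ℝ}
    (hq : ∀ᶠ ε in 𝓝[>] (0 : ℝ), q ε ∈ atomSet (νe ε))
    (hlim : Tendsto q (𝓝[>] (0 : ℝ)) (𝓝 p)) {w : ℝ} (hw : 0 < w) :
    ∃ r > 0, ∀ᶠ ε in 𝓝[>] (0 : ℝ), ∀ a ∈ atomSet (νe ε),
      a.1 ∈ Metric.ball p.1 r → w < a.2 → a = q ε := by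
  obtain ⟨r, hr, hmass⟩ := hvague.exists_eventually_measureReal_ball_le hloc p.1 (half_pos hw)
  refine ⟨r, hr, ?_⟩
  filter_upwards [hmass, hq, hlim.fst_nhds.eventually (Metric.ball_mem_nhds p.1 hr),
    hlim.snd_nhds.eventually_const_lt (sub_lt_self p.2 (half_pos hw)), self_mem_nhdsWithin]
    with ε hmass hq hball hweight hpos a ha har haw
  have := hloc ε hpos
  by_contra hne
  have := snd_add_snd_le_measureReal_of_mem_atomSet ha hq hne har hball
  rw [measureReal_singleton_of_mem_atomSet hp] at hmass
  linarith

theorem VagueTo.exists_nhds_eventually_eq {νe : ℝ → Measure ℝ} {ν : Measure ℝ}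
    [IsLocallyFiniteMeasure ν] (hloc : ∀ ε > (0 : ℝ), IsLocallyFiniteMeasure (νe ε))
    (hvague : VagueTo νe ν) {p : ℝ × ℝ} (hp : p ∈ atomSet ν) {q : ℝ → ℝ × ℝ}
    (hq : ∀ᶠ ε in 𝓝[>] (0 : ℝ), q ε ∈ atomSet (νe ε))
    (hlim : Tendsto q (𝓝[>] (0 : ℝ)) (𝓝 p)) :
    ∃ N ∈ 𝓝 p, ∀ᶠ ε in 𝓝[>] (0 : ℝ), ∀ a ∈ atomSet (νe ε) ∩ N, a = q ε := by
  obtain ⟨r, hr, h⟩ := hvague.exists_eventually_eq_of_tendsto hloc hp hq hlim (half_pos hp.1)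
  refine ⟨Metric.ball p.1 r ×ˢ Ioi (p.2 / 2), prod_mem_nhds (Metric.ball_mem_nhds _ hr)
    (Ioi_mem_nhds (half_lt_self hp.1)), ?_⟩
  filter_upwards [h] with ε h a ha
  exact h a ha.1 ha.2.1 ha.2.2

/-- Under vague convergence and `Cond1`, atoms of `νe ε` do not accumulate at points of
`ℝ × (0, ∞)` that are not atoms of the limit. -/
theorem VagueTo.exists_nhds_eventually_notMem {νe : ℝ → Measure ℝ} {ν : Measure ℝ}
    [IsLocallyFiniteMeasure ν] (hloc : ∀ ε > (0 : ℝ), IsLocallyFiniteMeasure (νe ε))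
    (hcond : Cond1 νe ν) (hvague : VagueTo νe ν) {p : ℝ × ℝ} (hp0 : 0 < p.2)
    (hp : p ∉ atomSet ν) :
    ∃ N ∈ 𝓝 p, ∀ᶠ ε in 𝓝[>] (0 : ℝ), ∀ a ∈ atomSet (νe ε), a ∉ N := by
  have hne : ν.real {p.1} ≠ p.2 := fun h => hp ⟨hp0, h⟩
  rcases hne.lt_or_gt with hlt | hlt
  · obtain ⟨r, hr, h⟩ := hvague.exists_eventually_measureReal_ball_le hloc p.1
      (half_pos (sub_pos.2 hlt))
    refine ⟨Metric.ball p.1 r ×ˢ Ioi ((ν.real {p.1} + p.2) / 2),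
      prod_mem_nhds (Metric.ball_mem_nhds _ hr) (Ioi_mem_nhds (by linarith)), ?_⟩
    filter_upwards [h, self_mem_nhdsWithin] with ε h hpos a ha haN
    have := hloc ε hpos
    have h₁ := snd_le_measureReal_of_mem_atomSet ha haN.1
    have h₂ : (ν.real {p.1} + p.2) / 2 < a.2 := haN.2
    linarith
  · have hatom : (p.1, ν.real {p.1}) ∈ atomSet ν := ⟨hp0.trans hlt, rfl⟩
    obtain ⟨q, hq, hlim⟩ := hcond _ hatom
    obtain ⟨r, hr, h⟩ := hvague.exists_eventually_eq_of_tendsto hloc hatom hq hlim (half_pos hp0)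
    refine ⟨Metric.ball p.1 r ×ˢ Ioo (p.2 / 2) ((ν.real {p.1} + p.2) / 2),
      prod_mem_nhds (Metric.ball_mem_nhds _ hr)
        (Ioo_mem_nhds (half_lt_self hp0) (by linarith)), ?_⟩
    filter_upwards [h, hlim.snd_nhds.eventually_const_lt
      (show (ν.real {p.1} + p.2) / 2 < ν.real {p.1} by linarith)] with ε h hweight a ha haN
    have h₁ := h a ha haN.1 haN.2.1
    have h₂ := haN.2.2
    rw [h₁] at h₂
    exact lt_asymm h₂ hweight

theorem finite_atomSet_inter_of_isCompact (ν : Measure ℝ) [IsLocallyFiniteMeasure ν]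
    {K : Set (ℝ × ℝ)} (hK : IsCompact K) (hpos : K ⊆ {p : ℝ × ℝ | 0 < p.2}) :
    (atomSet ν ∩ K).Finite := by
  have hloc : ∀ ε > (0 : ℝ), IsLocallyFiniteMeasure ((fun _ => ν) ε) := fun _ _ => inferInstance
  have hvague : VagueTo (fun _ => ν) ν := fun _ _ _ => tendsto_const_nhds
  have hcond : Cond1 (fun _ => ν) ν := fun p hp =>
    ⟨fun _ => p, Eventually.of_forall fun _ => hp, tendsto_const_nhds⟩
  refine hK.induction_on (p := fun s => (atomSet ν ∩ s).Finite) (by simp)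
    (fun s t hst ht => ht.subset (inter_subset_inter_right _ hst))
    (fun s t hs ht => by simpa only [inter_union_distrib_left] using hs.union ht) fun p hp => ?_
  by_cases hpV : p ∈ atomSet ν
  · obtain ⟨N, hN, h⟩ := hvague.exists_nhds_eventually_eq hloc hpV
      (Eventually.of_forall fun _ => hpV) tendsto_const_nhds
    obtain ⟨_, h⟩ := h.exists
    exact ⟨N, mem_nhdsWithin_of_mem_nhds hN, (finite_singleton p).subset h⟩
  · obtain ⟨N, hN, h⟩ := hvague.exists_nhds_eventually_notMem hloc hcond (hpos hp) hpV
    obtain ⟨_, h⟩ := h.exists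
    exact ⟨N, mem_nhdsWithin_of_mem_nhds hN, finite_empty.subset fun a ha => h a ha.1 ha.2⟩

/-- Second assertion of Proposition 2.1: Condition 1 together with vague
convergence implies point process convergence. -/
theorem cond1_and_vague_implies_pp_convergence
    (ν : Measure ℝ) (νe : ℝ → Measure ℝ)
    [IsLocallyFiniteMeasure ν]
    (hloc : ∀ ε > (0 : ℝ), IsLocallyFiniteMeasure (νe ε))
    (hν : ν ≠ 0) (hνe : ∀ ε > (0 : ℝ), νe ε ≠ 0)
    (hcond : Cond1 νe ν) (hvague : VagueTo νe ν) :
    PPTo νe ν := by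
  intro U hU hK hpos hfr
  have hF : (atomSet ν ∩ U).Finite :=
    (finite_atomSet_inter_of_isCompact ν hK hpos).subset (inter_subset_inter_right _ subset_closure)
  choose! q hq hlim using hcond
  have hcover : ∀ᶠ ε in 𝓝[>] (0 : ℝ), ∀ a ∈ atomSet (νe ε) ∩ closure U,
      a ∈ (fun p => q p ε) '' (atomSet ν ∩ U) := by
    refine hK.induction_on (p := fun s => ∀ᶠ ε in 𝓝[>] (0 : ℝ), ∀ a ∈ atomSet (νe ε) ∩ s,
      a ∈ (fun p => q p ε) '' (atomSet ν ∩ U)) (by simp)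
      (fun s t hst ht => ht.mono fun ε h a ha => h a ⟨ha.1, hst ha.2⟩)
      (fun s t hs ht => ?_) fun p hp => ?_
    · filter_upwards [hs, ht] with ε hs ht a ha
      exact ha.2.elim (fun h => hs a ⟨ha.1, h⟩) fun h => ht a ⟨ha.1, h⟩
    · by_cases hpV : p ∈ atomSet ν
      · have hpU : p ∈ U := by
          by_contra hpU
          exact hfr p (hU.frontier_eq ▸ ⟨hp, hpU⟩) hpV
        obtain ⟨N, hN, h⟩ := hvague.exists_nhds_eventually_eq hloc hpV (hq p hpV) (hlim p hpV)
        exact ⟨N, mem_nhdsWithin_of_mem_nhds hN,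
          h.mono fun ε h a ha => ⟨p, ⟨hpV, hpU⟩, (h a ha).symm⟩⟩
      · obtain ⟨N, hN, h⟩ := hvague.exists_nhds_eventually_notMem hloc
          (fun p hp => ⟨q p, hq p hp, hlim p hp⟩) (hpos hp) hpV
        exact ⟨N, mem_nhdsWithin_of_mem_nhds hN,
          h.mono fun ε h a ha => (h a ha.1 ha.2).elim⟩
  have hmem : ∀ᶠ ε in 𝓝[>] (0 : ℝ), ∀ p ∈ atomSet ν ∩ U, q p ε ∈ atomSet (νe ε) ∩ U :=
    (eventually_all_finite hF).2 fun p hp =>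
      (hq p hp.1).and ((hlim p hp.1).eventually (hU.mem_nhds hp.2))
  have hinj : ∀ᶠ ε in 𝓝[>] (0 : ℝ), InjOn (fun p => q p ε) (atomSet ν ∩ U) := by
    have h : ∀ᶠ ε in 𝓝[>] (0 : ℝ), ∀ p ∈ atomSet ν ∩ U, ∀ p' ∈ atomSet ν ∩ U,
        p ≠ p' → q p ε ≠ q p' ε :=
      (eventually_all_finite hF).2 fun p hp => (eventually_all_finite hF).2 fun p' hp' =>
        eventually_imp_distrib_left.2 fun hne => 
          ((hlim p hp.1).prodMk_nhds (hlim p' hp'.1)).eventually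
            (isClosed_diagonal.isOpen_compl.mem_nhds hne)
    filter_upwards [h] with ε h p hp p' hp' heq
    by_contra hne
    exact h p hp p' hp' hne heq
  filter_upwards [hcover, hmem, hinj] with ε hcover hmem hinj
  rw [← hinj.ncard_image]
  congr 1
  exact Subset.antisymm (fun a ha => hcover a ⟨ha.1, subset_closure ha.2⟩) (image_subset_iff.2 hmem)

end
end

section
/- Let ν and ν^ε (ε>0) be Borel probability measures on ℝ such that, as ε→0, both ν^ε → ν in the point process sense and ν^ε → ν vaguely. Then for every bounded continuous function f : (0,∞) → ℝ that vanishes on some neighborhood of 0 (i.e., f(w)=0 for all w in some interval (0,δ) with δ>0), the sums over atoms converge: ∑_{y atom of ν^ε} f(ν^ε({y})) → ∑_{y atom of ν} f(ν({y})) as ε→0. (Equivalently, the counting measures D(ν^ε) on (0,1] of the atom weights of ν^ε converge to D(ν) in the stated sense.) -/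
open MeasureTheory Filter Topology Set

noncomputable section

/-- A probability measure has finitely many atoms of weight at least `η > 0`. -/
lemma finite_atomSet_inter_weight_ge (ν : Measure ℝ) [IsProbabilityMeasure ν] {η : ℝ}
    (hη : 0 < η) : (atomSet ν ∩ {p | η ≤ p.2}).Finite := by
  have hfin : {y : ℝ | ENNReal.ofReal η ≤ ν {y}}.Finite :=
    Measure.finite_const_le_meas_of_disjoint_iUnion ν (ENNReal.ofReal_pos.2 hη)
      (fun y => measurableSet_singleton y)
      (fun x y hxy => by simpa [Function.onFun] using hxy) (measure_ne_top ν _)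
  refine (hfin.image fun y => (y, (ν {y}).toReal)).subset ?_
  rintro ⟨y, w⟩ ⟨⟨-, hw⟩, hηw⟩
  refine ⟨y, ?_, Prod.ext rfl hw⟩
  rw [mem_ofPred_eq, ENNReal.ofReal_le_iff_le_toReal (measure_ne_top ν _)]
  exact hηw.trans hw.ge

lemma snd_le_one_of_mem_atomSet {ν : Measure ℝ} [IsProbabilityMeasure ν] {p : ℝ × ℝ}
    (hp : p ∈ atomSet ν) : p.2 ≤ 1 :=
  hp.2 ▸ (measureReal_le_one : ν.real {p.1} ≤ 1)

/-- The sum over atoms as a finite sum over those points of `V(ν)` where `f` may not vanish. -/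
lemma tsum_atoms_eq_sum (ν : Measure ℝ) [IsProbabilityMeasure ν] (f : ℝ → ℝ)
    {U : Set (ℝ × ℝ)} {T : Finset (ℝ × ℝ)} (hT : (T : Set (ℝ × ℝ)) = atomSet ν ∩ U)
    (hf : ∀ p ∈ atomSet ν, p ∉ U → f p.2 = 0) :
    ∑' y : {y : ℝ | 0 < ν {y}}, f ((ν {(y : ℝ)}).toReal) = ∑ p ∈ T, f p.2 := by
  let e : {y : ℝ | 0 < ν {y}} ≃ atomSet ν :=
    { toFun := fun y =>
        ⟨(y, (ν {(y : ℝ)}).toReal), ENNReal.toReal_pos y.2.ne' (measure_ne_top ν _), rfl⟩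
      invFun := fun p => ⟨p.1.1, (ENNReal.toReal_pos_iff.1 (p.2.2.symm ▸ p.2.1)).1⟩
      left_inv := fun _ => rfl
      right_inv := fun p => Subtype.ext (Prod.ext rfl p.2.2) }
  have hmem : ∀ p, p ∈ T ↔ p ∈ atomSet ν ∩ U := fun p => by rw [← hT, Finset.mem_coe]
  calc ∑' y : {y : ℝ | 0 < ν {y}}, f ((ν {(y : ℝ)}).toReal)
      = ∑' p : atomSet ν, f (p : ℝ × ℝ).2 := e.tsum_eq fun p : atomSet ν => f (p : ℝ × ℝ).2
    _ = ∑' p, (atomSet ν).indicator (fun p => f p.2) p :=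
        tsum_subtype (atomSet ν) fun p : ℝ × ℝ => f p.2
    _ = ∑ p ∈ T, (atomSet ν).indicator (fun p => f p.2) p := by
        refine tsum_eq_sum fun p hp => ?_
        by_cases hpν : p ∈ atomSet ν
        · rw [indicator_of_mem hpν]
          exact hf p hpν fun hU => hp ((hmem p).2 ⟨hpν, hU⟩)
        · exact indicator_of_notMem hpν _
    _ = ∑ p ∈ T, f p.2 :=
        Finset.sum_congr rfl fun p hp => indicator_of_mem ((hmem p).1 hp).1 _

/-- Continuous cutoff: equal to `1` on `[-(n-1), n-1]` and to `0` outside `(-n, n)`. -/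
def cutoff (n : ℕ) (x : ℝ) : ℝ := max 0 (min 1 (n - |x|))

lemma continuous_cutoff (n : ℕ) : Continuous (cutoff n) := by
  unfold cutoff; fun_prop

lemma cutoff_nonneg (n : ℕ) (x : ℝ) : 0 ≤ cutoff n x := le_max_left _ _

lemma cutoff_le_one (n : ℕ) (x : ℝ) : cutoff n x ≤ 1 :=
  max_le zero_le_one (min_le_left _ _)

lemma norm_cutoff_le_one (n : ℕ) (x : ℝ) : ‖cutoff n x‖ ≤ 1 := by
  rw [Real.norm_of_nonneg (cutoff_nonneg n x)]
  exact cutoff_le_one n x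

lemma cutoff_eq_zero {n : ℕ} {x : ℝ} (h : n ≤ |x|) : cutoff n x = 0 :=
  max_eq_left ((min_le_right _ _).trans (sub_nonpos.2 h))

lemma hasCompactSupport_cutoff (n : ℕ) : HasCompactSupport (cutoff n) := by
  refine HasCompactSupport.intro (isCompact_Icc (a := -(n : ℝ)) (b := n)) fun x hx => ?_
  refine cutoff_eq_zero ?_
  by_contra! h
  exact hx (abs_le.1 h.le)

lemma tendsto_integral_cutoff (ν : Measure ℝ) [IsProbabilityMeasure ν] :
    Tendsto (fun n => ∫ x, cutoff n x ∂ν) atTop (𝓝 1) := by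
  have h : Tendsto (fun n => ∫ x, cutoff n x ∂ν) atTop (𝓝 (∫ _, (1 : ℝ) ∂ν)) := by
    refine tendsto_integral_of_dominated_convergence (fun _ => 1)
      (fun n => (continuous_cutoff n).aestronglyMeasurable) (integrable_const _)
      (fun n => ae_of_all _ (norm_cutoff_le_one n)) (ae_of_all _ fun x => ?_)
    refine tendsto_const_nhds.congr' ?_
    filter_upwards [eventually_ge_atTop ⌈|x| + 1⌉₊] with n hn
    have hn' : |x| + 1 ≤ n := Nat.ceil_le.1 hn
    rw [cutoff, min_eq_left (by linarith), max_eq_right zero_le_one]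
  simpa using h

lemma measure_singleton_le_one_sub_integral_cutoff (ν : Measure ℝ) [IsProbabilityMeasure ν]
    {n : ℕ} {y : ℝ} (hy : n ≤ |y|) :
    (ν {y}).toReal ≤ 1 - ∫ x, cutoff n x ∂ν := by
  have hint : Integrable (cutoff n) ν :=
    (integrable_const (1 : ℝ)).mono' (continuous_cutoff n).aestronglyMeasurable
      (ae_of_all _ (norm_cutoff_le_one n))
  have hind : Integrable (({y} : Set ℝ).indicator fun _ => (1 : ℝ)) ν :=
    (integrable_const 1).indicator (measurableSet_singleton y)
  have h1 : ∫ x, ({y} : Set ℝ).indicator (fun _ => (1 : ℝ)) x ∂ν = (ν {y}).toReal := by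
    rw [integral_indicator_const _ (measurableSet_singleton y), smul_eq_mul, mul_one,
      measureReal_def]
  have h2 : ∫ x, (({y} : Set ℝ).indicator (fun _ => (1 : ℝ)) x + cutoff n x) ∂ν ≤
      ∫ _, (1 : ℝ) ∂ν := by
    refine integral_mono (hind.add hint) (integrable_const 1) fun x => ?_
    by_cases hx : x = y
    · simp [hx, cutoff_eq_zero hy]
    · simpa [hx] using cutoff_le_one n x
  rw [integral_add hind hint, h1] at h2
  have h3 : ∫ _, (1 : ℝ) ∂ν = 1 := by simp
  linarith

/-- If `V(ν)` has the finitely many points `S` in an admissible open set `U`, then eventually the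
points of `V(ν^ε)` in `U` are in bijection with `S`, each within distance `r` of its partner. -/
lemma PPTo.eventually_exists_bijOn {νe : ℝ → Measure ℝ} {ν : Measure ℝ} (hpp : PPTo νe ν)
    {U : Set (ℝ × ℝ)} (hU : IsOpen U) (hUc : IsCompact (closure U))
    (hUpos : closure U ⊆ {p : ℝ × ℝ | 0 < p.2}) (hUf : ∀ p ∈ frontier U, p ∉ atomSet ν)
    {S : Set (ℝ × ℝ)} (hSfin : S.Finite) (hS : S = atomSet ν ∩ U)
    (hfin : ∀ᶠ ε in 𝓝[>] (0 : ℝ), (atomSet (νe ε) ∩ U).Finite) {W : ℝ × ℝ → Set (ℝ × ℝ)}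
    (hW : ∀ p ∈ S, W p ∈ 𝓝 p) :
    ∀ᶠ ε in 𝓝[>] (0 : ℝ), ∃ q : ℝ × ℝ → ℝ × ℝ,
      BijOn q S (atomSet (νe ε) ∩ U) ∧ ∀ p ∈ S, q p ∈ W p := by
  have hsep : ∀ p ∈ S, ∀ᶠ r in 𝓝[>] (0 : ℝ), ∀ p' ∈ S, p ≠ p' → r < dist p p' / 2 := by
    intro p _
    rw [hSfin.eventually_all]
    intro p' _
    by_cases h : p = p'
    · simp [h]
    · have : 0 < dist p p' / 2 := half_pos (dist_pos.2 h)
      filter_upwards [nhdsWithin_le_nhds (Iio_mem_nhds this)] with r hr _ using hr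
  have hball : ∀ p ∈ S, ∀ᶠ r in 𝓝[>] (0 : ℝ), Metric.closedBall p r ⊆ U ∩ W p := by
    intro p hp
    have hUW : U ∩ W p ∈ 𝓝 p := inter_mem (hU.mem_nhds (hS ▸ hp : p ∈ _ ∩ U).2) (hW p hp)
    obtain ⟨ρ, hρ, hsub⟩ := Metric.nhds_basis_closedBall.mem_iff.1 hUW
    filter_upwards [nhdsWithin_le_nhds (Iio_mem_nhds hρ)] with r hr
    exact (Metric.closedBall_subset_closedBall (le_of_lt hr)).trans hsub
  obtain ⟨r, hr, hrsep, hrball⟩ := (eventually_mem_nhdsWithin.and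
    ((hSfin.eventually_all.2 hsep).and (hSfin.eventually_all.2 hball))).exists
  replace hr : 0 < r := hr
  have honly : ∀ p ∈ S, ∀ x ∈ Metric.closedBall p r, x ∈ atomSet ν → x = p := by
    intro p hp x hx hxν
    by_contra hne
    have := hrsep p hp x (hS ▸ ⟨hxν, (hrball p hp hx).1⟩) (Ne.symm hne)
    rw [Metric.mem_closedBall, dist_comm] at hx
    linarith
  have hone : ∀ p ∈ S, ∀ᶠ ε in 𝓝[>] (0 : ℝ),
      (atomSet (νe ε) ∩ Metric.ball p r).ncard = 1 := by
    intro p hp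
    have hcl : closure (Metric.ball p r) ⊆ Metric.closedBall p r :=
      Metric.closure_ball_subset_closedBall
    have hclU : closure (Metric.ball p r) ⊆ closure U :=
      closure_mono (Metric.ball_subset_closedBall.trans ((hrball p hp).trans inter_subset_left))
    have hsingle : atomSet ν ∩ Metric.ball p r = {p} := by
      ext x
      constructor
      · rintro ⟨hxν, hx⟩
        exact honly p hp x (Metric.ball_subset_closedBall hx) hxν
      · rintro rfl
        exact ⟨(hS ▸ hp : x ∈ _ ∩ U).1, Metric.mem_ball_self hr⟩
    have := hpp (Metric.ball p r) Metric.isOpen_ball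
      (hUc.of_isClosed_subset isClosed_closure hclU) (hclU.trans hUpos) ?_
    · simpa [hsingle] using this
    · intro x hx hxν
      obtain rfl := honly p hp x (hcl (frontier_subset_closure hx)) hxν
      rw [Metric.isOpen_ball.frontier_eq] at hx
      exact hx.2 (Metric.mem_ball_self hr)
  filter_upwards [hSfin.eventually_all.2 hone, hpp U hU hUc hUpos hUf, hfin] with ε h1 h2 h3
  have hex : ∀ p, ∃ q, p ∈ S → q ∈ atomSet (νe ε) ∩ Metric.ball p r := by
    intro p
    by_cases hp : p ∈ S
    · obtain ⟨q, hq⟩ := ncard_eq_one.1 (h1 p hp)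
      exact ⟨q, fun _ => hq ▸ mem_singleton q⟩
    · exact ⟨p, fun h => absurd h hp⟩
  choose q hq using hex
  have hqU : ∀ p ∈ S, q p ∈ U ∩ W p := fun p hp =>
    hrball p hp (Metric.ball_subset_closedBall (hq p hp).2)
  have hinj : InjOn q S := by
    intro p hp p' hp' heq
    by_contra hne
    have hd := hrsep p hp p' hp' hne
    have hqp := Metric.mem_ball'.1 (hq p hp).2
    have hqp' := Metric.mem_ball.1 (hq p' hp').2
    rw [← heq] at hqp'
    have := dist_triangle p (q p) p'
    linarith
  have himg : q '' S = atomSet (νe ε) ∩ U := by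
    refine eq_of_subset_of_ncard_le ?_ ?_ h3
    · rintro _ ⟨p, hp, rfl⟩
      exact ⟨(hq p hp).1, (hqU p hp).1⟩
    · rw [hinj.ncard_image, h2, hS]
  exact ⟨q, ⟨fun p hp => ⟨(hq p hp).1, (hqU p hp).1⟩, hinj, himg.ge⟩, fun p hp => (hqU p hp).2⟩

/-- A window `(-R, R) × (η, 2)`, with `R > n` and `η < δ`, whose boundary avoids `V(ν)`. -/
lemma exists_window (ν : Measure ℝ) [IsProbabilityMeasure ν] (n : ℝ) {δ : ℝ} (hδ : 0 < δ) :
    ∃ R > n, ∃ η > 0, η < δ ∧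
      ∀ p ∈ frontier (Ioo (-R) R ×ˢ Ioo η 2), p ∉ atomSet ν := by
  have hF := finite_atomSet_inter_weight_ge ν (half_pos hδ)
  obtain ⟨R, hRn, hR⟩ :=
    ((Ioi_infinite n).sdiff (hF.image fun p => |p.1|)).nonempty
  obtain ⟨η, ⟨hη1, hη2⟩, hη⟩ :=
    ((Ioo_infinite (half_lt_self hδ)).sdiff (hF.image Prod.snd)).nonempty
  refine ⟨R, hRn, η, (half_pos hδ).trans hη1, hη2, fun p hp hpν => ?_⟩
  rw [(isOpen_Ioo.prod isOpen_Ioo).frontier_eq] at hp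
  have hcl : closure (Ioo (-R) R ×ˢ Ioo η 2) ⊆ Icc (-R) R ×ˢ Icc η 2 :=
    closure_minimal (prod_mono Ioo_subset_Icc_self Ioo_subset_Icc_self)
      (isClosed_Icc.prod isClosed_Icc)
  obtain ⟨⟨hp1, hp2⟩, ⟨hp3, -⟩⟩ := hcl hp.1
  have hpF : p ∈ atomSet ν ∩ {p | δ / 2 ≤ p.2} := ⟨hpν, hη1.le.trans hp3⟩
  have hpR : |p.1| ≠ R := fun h => hR ⟨p, hpF, h⟩
  have hpη : p.2 ≠ η := fun h => hη ⟨p, hpF, h⟩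
  have habs := abs_lt.1 ((abs_le.2 ⟨hp1, hp2⟩).lt_of_ne hpR)
  exact hp.2 ⟨habs, hp3.lt_of_ne' hpη, (snd_le_one_of_mem_atomSet hpν).trans_lt one_lt_two⟩

/-- Corollary 2.2: if `ν^ε → ν` both in the point process sense and vaguely
(all measures being probability measures), then for every bounded continuous
`f : (0,∞) → ℝ` vanishing in a neighborhood of `0`, the sums of `f` over the
atom weights converge; i.e. `D(ν^ε) ⇒ D(ν)`. -/
theorem atom_weight_counting_measures_tendsto
    (ν : Measure ℝ) (νe : ℝ → Measure ℝ)
    [IsProbabilityMeasure ν]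
    (hprob : ∀ ε > (0 : ℝ), IsProbabilityMeasure (νe ε))
    (hpp : PPTo νe ν) (hvague : VagueTo νe ν)
    (f : ℝ → ℝ) (hfc : ContinuousOn f (Set.Ioi 0))
    (hfb : ∃ C : ℝ, ∀ w > (0 : ℝ), |f w| ≤ C)
    (hf0 : ∃ δ > (0 : ℝ), ∀ w, 0 < w → w < δ → f w = 0) :
    Tendsto
      (fun ε => ∑' y : {y : ℝ | 0 < νe ε {y}}, f (((νe ε) {(y : ℝ)}).toReal))
      (𝓝[>] (0 : ℝ))
      (𝓝 (∑' y : {y : ℝ | 0 < ν {y}}, f ((ν {(y : ℝ)}).toReal))) := by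
  obtain ⟨δ, hδ, hfδ⟩ := hf0
  obtain ⟨n, hn⟩ := ((tendsto_integral_cutoff ν).eventually_const_lt
    (show 1 - δ < 1 by linarith)).exists
  obtain ⟨R, hRn, η, hη, hηδ, hfr⟩ := exists_window ν n hδ
  set U : Set (ℝ × ℝ) := Ioo (-R) R ×ˢ Ioo η 2
  have hvanish : ∀ μ : Measure ℝ, IsProbabilityMeasure μ → 1 - δ < ∫ x, cutoff n x ∂μ →
      ∀ p ∈ atomSet μ, p ∉ U → f p.2 = 0 := by
    intro μ _ hμ p hp hpU
    refine hfδ _ hp.1 ?_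
    by_contra! hle
    refine hpU ⟨abs_lt.1 ?_, hηδ.trans_le hle,
      (snd_le_one_of_mem_atomSet hp).trans_lt one_lt_two⟩
    by_contra! hR
    have := measure_singleton_le_one_sub_integral_cutoff μ (hRn.le.trans hR)
    rw [hp.2] at this
    linarith
  have hfinU : ∀ μ : Measure ℝ, IsProbabilityMeasure μ → (atomSet μ ∩ U).Finite :=
    fun μ _ => (finite_atomSet_inter_weight_ge μ hη).subset
      (inter_subset_inter_right _ fun p hp => hp.2.1.le)
  have hcl : closure U ⊆ Icc (-R) R ×ˢ Icc η 2 :=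
    closure_minimal (prod_mono Ioo_subset_Icc_self Ioo_subset_Icc_self)
      (isClosed_Icc.prod isClosed_Icc)
  have hS := hfinU ν inferInstance
  rw [tsum_atoms_eq_sum ν f hS.coe_toFinset (hvanish ν inferInstance hn), Metric.tendsto_nhds]
  intro τ hτ
  set c : ℝ := hS.toFinset.card + 1 with hc
  have hc0 : 0 < c := by positivity
  have hnear : ∀ p ∈ atomSet ν ∩ U, {x : ℝ × ℝ | dist (f x.2) (f p.2) < τ / c} ∈ 𝓝 p := by
    intro p hp
    have hcont : ContinuousAt (fun x : ℝ × ℝ => f x.2) p :=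
      ContinuousAt.comp (f := Prod.snd) (hfc.continuousAt (Ioi_mem_nhds hp.1.1)) continuousAt_snd
    exact Metric.tendsto_nhds.1 hcont _ (div_pos hτ hc0)
  have hprob' : ∀ᶠ ε in 𝓝[>] (0 : ℝ), IsProbabilityMeasure (νe ε) :=
    eventually_mem_nhdsWithin.mono hprob
  filter_upwards [hprob',
    (hvague _ (continuous_cutoff n) (hasCompactSupport_cutoff n)).eventually_const_lt hn,
    hpp.eventually_exists_bijOn (isOpen_Ioo.prod isOpen_Ioo)
      ((isCompact_Icc.prod isCompact_Icc).of_isClosed_subset isClosed_closure hcl)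
      (fun p hp => hη.trans_le (hcl hp).2.1) hfr hS rfl (hprob'.mono fun ε => hfinU (νe ε))
      hnear] with ε hε hcut ⟨q, hq, hqW⟩
  have hsum : ∑ x ∈ (hfinU (νe ε) hε).toFinset, f x.2 = ∑ p ∈ hS.toFinset, f (q p).2 := by
    symm
    refine Finset.sum_nbij q ?_ ?_ ?_ fun _ _ => rfl
    · intro p hp
      exact (hfinU (νe ε) hε).mem_toFinset.2 (hq.mapsTo (hS.mem_toFinset.1 hp))
    · simpa using hq.injOn
    · simpa using hq.surjOn
  rw [tsum_atoms_eq_sum (νe ε) f (hfinU (νe ε) hε).coe_toFinset (hvanish _ hε hcut), hsum]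
  calc dist (∑ p ∈ hS.toFinset, f (q p).2) (∑ p ∈ hS.toFinset, f p.2)
      ≤ ∑ p ∈ hS.toFinset, dist (f (q p).2) (f p.2) := dist_sum_sum_le _ _ _
    _ ≤ ∑ _p ∈ hS.toFinset, τ / c :=
        Finset.sum_le_sum fun p hp => (hqW p (hS.mem_toFinset.1 hp)).le
    _ = (c - 1) * (τ / c) := by rw [Finset.sum_const, nsmul_eq_mul, hc, add_sub_cancel_right]
    _ < c * (τ / c) := by
        have := div_pos hτ hc0
        nlinarith
    _ = τ := mul_div_cancel₀ _ hc0.ne'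

end
end

section
/- With F̄ the tail of τ₀ and c_ε defined from F̄ as below, one has (1/ε)·F̄(1/c_ε) → 1 as ε → 0⁺. -/
open MeasureTheory Filter Topology Set

noncomputable section

/-- A regularly varying function of index `-α` satisfies `F t / F (lam * t) → lam ^ α`. -/
theorem tendsto_div_comp_mul_of_slowly_varying {α : ℝ} {L F : ℝ → ℝ}
    (hLslow : ∀ lam > (0 : ℝ), Tendsto (fun t => L (lam * t) / L t) atTop (𝓝 1))
    (hF : ∀ t > (0 : ℝ), F t = L t / t ^ α) {lam : ℝ} (hlam : 0 < lam) :
    Tendsto (fun t => F t / F (lam * t)) atTop (𝓝 (lam ^ α)) := by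
  have h : Tendsto (fun t => lam ^ α * (L (lam * t) / L t)⁻¹) atTop (𝓝 (lam ^ α)) := by
    simpa using ((hLslow lam hlam).inv₀ one_ne_zero).const_mul (lam ^ α)
  refine h.congr' ?_
  filter_upwards [eventually_gt_atTop 0] with t ht
  have h1 : t ^ α ≠ 0 := (Real.rpow_pos_of_pos ht α).ne'
  rw [hF t ht, hF _ (mul_pos hlam ht), Real.mul_rpow hlam.le ht.le, inv_div, div_div_div_eq,
    mul_comm (t ^ α) (L _), ← mul_assoc, mul_div_mul_right _ _ h1, mul_comm (L t), mul_div_assoc]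

/-- The tail of a finite law tends to `0` at infinity. -/
theorem tendsto_measure_gt_toReal_atTop_zero {Ω : Type*} [MeasurableSpace Ω] (P : Measure Ω)
    [IsFiniteMeasure P] {X : Ω → ℝ} (hX : Measurable X) :
    Tendsto (fun t => (P {ω | t < X ω}).toReal) atTop (𝓝 0) := by
  have hempty : ⋂ t : ℝ, {ω | t < X ω} = ∅ := by
    ext ω
    simp only [mem_iInter, mem_ofPred_eq, mem_empty_iff_false, iff_false, not_forall, not_lt]
    exact ⟨X ω, le_rfl⟩
  have h := tendsto_measure_iInter_atTop (μ := P) (s := fun t : ℝ => {ω | t < X ω})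
    (fun t => (measurableSet_lt measurable_const hX).nullMeasurableSet)
    (fun _ _ hst _ hω => lt_of_le_of_lt hst hω) ⟨0, measure_ne_top _ _⟩
  rw [hempty, measure_empty] at h
  simpa [Function.comp_def] using (ENNReal.tendsto_toReal ENNReal.zero_ne_top).comp h

/-- Lemma 3.3 (Lemma A): `(1/ε)·F̄(1/c_ε) → 1` as `ε → 0⁺`. -/
theorem one_div_eps_tail_at_inv_c_tendsto_one
    {Ω : Type*} [MeasurableSpace Ω] (P : Measure Ω) [IsProbabilityMeasure P]
    (τ : Ω → ℝ) (hτ : Measurable τ)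
    (α : ℝ) (hα0 : 0 < α) (hα1 : α < 1)
    (L : ℝ → ℝ) (hLpos : ∀ t > (0 : ℝ), 0 < L t)
    (hLslow : ∀ lam > (0 : ℝ), Tendsto (fun t => L (lam * t) / L t) atTop (𝓝 1))
    (hpos : P {ω | 0 < τ ω} = 1)
    (Fbar : ℝ → ℝ) (hFbar : ∀ t, Fbar t = (P {ω | t < τ ω}).toReal)
    (htail : ∀ t > (0 : ℝ), Fbar t = L t / t ^ α)
    (c : ℝ → ℝ) (hc : ∀ ε, c ε = (sInf {t : ℝ | 0 ≤ t ∧ Fbar t ≤ ε})⁻¹)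
    :
    Tendsto (fun ε => (1 / ε) * Fbar (c ε)⁻¹) (𝓝[>] (0 : ℝ)) (𝓝 1) := by
  have hanti : Antitone Fbar := fun s t hst => by
    rw [hFbar, hFbar]
    exact ENNReal.toReal_mono (measure_ne_top _ _)
      (measure_mono fun ω hω => lt_of_le_of_lt hst hω)
  have hFpos : ∀ t > 0, 0 < Fbar t := fun t ht => by
    rw [htail t ht]
    exact div_pos (hLpos t ht) (Real.rpow_pos_of_pos ht α)
  have hF0 : Tendsto Fbar atTop (𝓝 0) := by
    rw [funext hFbar]
    exact tendsto_measure_gt_toReal_atTop_zero P hτ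
  set T : ℝ → ℝ := fun ε => sInf {t : ℝ | 0 ≤ t ∧ Fbar t ≤ ε} with hT
  have hcT : ∀ ε, (c ε)⁻¹ = T ε := fun ε => by rw [hc, inv_inv]
  simp only [hcT]
  have hne : ∀ ε > 0, {t : ℝ | 0 ≤ t ∧ Fbar t ≤ ε}.Nonempty := fun ε hε =>
    ((eventually_ge_atTop 0).and (hF0.eventually_le_const hε)).exists
  have hbdd : ∀ ε, BddBelow {t : ℝ | 0 ≤ t ∧ Fbar t ≤ ε} := fun ε => ⟨0, fun t ht => ht.1⟩
  have hTtop : Tendsto T (𝓝[>] 0) atTop := by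
    refine tendsto_atTop.2 fun M => ?_
    have hM : 0 < Fbar (max M 1) := hFpos _ (lt_max_of_lt_right one_pos)
    filter_upwards [Ioo_mem_nhdsGT hM] with ε hε
    refine le_csInf (hne ε hε.1) fun t ht => (le_max_left M 1).trans ?_
    by_contra! hlt
    exact absurd (hanti hlt.le) (not_le.2 (ht.2.trans_lt hε.2))
  have hratio : ∀ lam > 0,
      Tendsto (fun ε => Fbar (T ε) / Fbar (lam * T ε)) (𝓝[>] 0) (𝓝 (lam ^ α)) := fun lam hlam =>
    (tendsto_div_comp_mul_of_slowly_varying hLslow htail hlam).comp hTtop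
  have hcont : Tendsto (fun lam : ℝ => lam ^ α) (𝓝 1) (𝓝 1) := by
    simpa using (Real.continuousAt_rpow_const 1 α (Or.inl one_ne_zero)).tendsto
  refine tendsto_order.2 ⟨fun a ha => ?_, fun a ha => ?_⟩
  · obtain ⟨lam, hlam, h0, h1⟩ := (((hcont.mono_left nhdsWithin_le_nhds).eventually_const_lt ha).and
      (Ioo_mem_nhdsLT (zero_lt_one' ℝ))).exists
    filter_upwards [(hratio lam h0).eventually_const_lt hlam, hTtop.eventually_gt_atTop 0,
      self_mem_nhdsWithin] with ε hε hTε hε0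
    have hlt : ε < Fbar (lam * T ε) := by
      by_contra! hle
      have := csInf_le (hbdd ε) ⟨(mul_pos h0 hTε).le, hle⟩
      exact absurd this (not_le.2 (mul_lt_of_lt_one_left hTε h1))
    rw [one_div_mul_eq_div]
    exact hε.trans_le (div_le_div_of_nonneg_left (hFpos _ hTε).le hε0 hlt.le)
  · obtain ⟨lam, hlam, h1⟩ := (((hcont.mono_left nhdsWithin_le_nhds).eventually_lt_const ha).and
      (self_mem_nhdsWithin (s := Ioi (1 : ℝ)))).exists
    have h1 : 1 < lam := h1
    have h0 : 0 < lam := one_pos.trans h1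
    filter_upwards [(hratio lam h0).eventually_lt_const hlam, hTtop.eventually_gt_atTop 0,
      self_mem_nhdsWithin] with ε hε hTε hε0
    obtain ⟨t, ht, htlt⟩ := exists_lt_of_csInf_lt (hne ε hε0) (lt_mul_of_one_lt_left hTε h1)
    have hle : Fbar (lam * T ε) ≤ ε := (hanti htlt.le).trans ht.2
    rw [one_div_mul_eq_div]
    exact (div_le_div_of_nonneg_left (hFpos _ hTε).le (hFpos _ (mul_pos h0 hTε)) hle).trans_lt hε

end
end

section
/- With F̄ the tail of τ₀ and c_ε defined from F̄ as below, for every fixed y > 0 one has (1/ε)·F̄(y/c_ε) → y^{-α} as ε → 0⁺. -/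
open MeasureTheory Filter Topology Set

noncomputable section

/-- The tail of a real random variable vanishes at infinity. -/
theorem tendsto_tail_atTop {Ω : Type*} [MeasurableSpace Ω] (P : Measure Ω)
    [IsFiniteMeasure P] {τ : Ω → ℝ} (hτ : Measurable τ) :
    Tendsto (fun t : ℝ => (P {ω | t < τ ω}).toReal) atTop (𝓝 0) := by
  have hinter : ⋂ t : ℝ, {ω | t < τ ω} = ∅ := by
    ext ω
    simp only [mem_iInter, mem_ofPred_eq, mem_empty_iff_false, iff_false, not_forall, not_lt]
    exact ⟨τ ω, le_rfl⟩
  have h := tendsto_measure_iInter_atTop (μ := P) (s := fun t : ℝ => {ω | t < τ ω})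
    (fun t => (measurableSet_lt measurable_const hτ).nullMeasurableSet)
    (fun s t hst ω (hω : t < τ ω) => lt_of_le_of_lt hst hω) ⟨0, measure_ne_top _ _⟩
  rw [hinter, measure_empty] at h
  exact (ENNReal.tendsto_toReal ENNReal.zero_ne_top).comp h

/-- A function `L t / t ^ α` with `L` slowly varying is regularly varying of index `-α`. -/
theorem tendsto_ratio_of_slowlyVarying {F L : ℝ → ℝ} {α : ℝ}
    (hLslow : ∀ lam > (0 : ℝ), Tendsto (fun t => L (lam * t) / L t) atTop (𝓝 1))
    (hF : ∀ t > (0 : ℝ), F t = L t / t ^ α) {r s : ℝ} (hr : 0 < r) (hs : 0 < s) :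
    Tendsto (fun t => F (s * t) / F (r * t)) atTop (𝓝 ((s / r) ^ (-α))) := by
  have hsr : 0 < s / r := div_pos hs hr
  have h := ((hLslow (s / r) hsr).comp (tendsto_id.const_mul_atTop hr)).mul_const
    ((s / r) ^ (-α))
  rw [one_mul] at h
  refine h.congr' ?_
  filter_upwards [eventually_gt_atTop 0] with t ht
  have hrt : 0 < r * t := mul_pos hr ht
  have hst : s * t = s / r * (r * t) := by field_simp
  have h1 : 0 < (s / r) ^ α := Real.rpow_pos_of_pos hsr α
  have h2 : 0 < (r * t) ^ α := Real.rpow_pos_of_pos hrt α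
  simp only [Function.comp_apply, id]
  rw [hF _ (mul_pos hs ht), hF _ hrt, hst, Real.mul_rpow hsr.le hrt.le, Real.rpow_neg hsr.le]
  field_simp

/-- The generalized inverse of a positive antitone function tends to infinity at `0`. -/
theorem tendsto_generalizedInverse_atTop {F : ℝ → ℝ} (hanti : Antitone F)
    (hpos : ∀ t > (0 : ℝ), 0 < F t) (hlim : Tendsto F atTop (𝓝 0)) :
    Tendsto (fun ε => sInf {t : ℝ | 0 ≤ t ∧ F t ≤ ε}) (𝓝[>] (0 : ℝ)) atTop := by
  refine tendsto_atTop.2 fun T => ?_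
  have hT : 0 < F (max T 1) := hpos _ (by positivity)
  filter_upwards [Ioo_mem_nhdsGT hT] with ε hε
  obtain ⟨t, ht0, htε⟩ :=
    ((eventually_ge_atTop 0).and (hlim.eventually_lt_const hε.1)).exists
  refine le_csInf ⟨t, ht0, htε.le⟩ fun s hs => ?_
  by_contra! hsT
  have := hanti (hsT.le.trans (le_max_left T 1))
  linarith [hs.2, hε.2]

/-- Composing a positive antitone regularly varying function with its generalized inverse. -/
theorem tendsto_comp_generalizedInverse {F : ℝ → ℝ} {α : ℝ} (hanti : Antitone F)
    (hpos : ∀ t > (0 : ℝ), 0 < F t) (hlim : Tendsto F atTop (𝓝 0))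
    (hreg : ∀ r > (0 : ℝ), ∀ s > (0 : ℝ),
      Tendsto (fun t => F (s * t) / F (r * t)) atTop (𝓝 ((s / r) ^ (-α))))
    {y : ℝ} (hy : 0 < y) :
    Tendsto (fun ε => F (y * sInf {t : ℝ | 0 ≤ t ∧ F t ≤ ε}) / ε) (𝓝[>] (0 : ℝ))
      (𝓝 (y ^ (-α))) := by
  have ha := tendsto_generalizedInverse_atTop hanti hpos hlim
  have hcont : Tendsto (fun r : ℝ => (y / r) ^ (-α)) (𝓝 1) (𝓝 (y ^ (-α))) := by
    have h : Tendsto (fun r : ℝ => y / r) (𝓝 1) (𝓝 y) := by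
      have h := (tendsto_const_nhds (x := y)).div (tendsto_id (α := ℝ) (x := 𝓝 1)) one_ne_zero
      rwa [div_one] at h
    exact h.rpow_const (Or.inl hy.ne')
  refine tendsto_order.2 ⟨fun b hb => ?_, fun b hb => ?_⟩
  · obtain ⟨r, hbr, hr0, hr1⟩ :=
      (((hcont.mono_left nhdsWithin_le_nhds).eventually_const_lt hb).and
        (Ioo_mem_nhdsLT (zero_lt_one' ℝ))).exists
    filter_upwards [((hreg r hr0 y hy).comp ha).eventually_const_lt hbr,
      ha.eventually_gt_atTop 0, self_mem_nhdsWithin] with ε hε hpos_a hε0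
    have hε0 : 0 < ε := hε0
    refine lt_of_lt_of_le hε ?_
    have hle : ε ≤ F (r * sInf {t : ℝ | 0 ≤ t ∧ F t ≤ ε}) := by
      by_contra! hlt
      have := csInf_le ⟨0, fun t (ht : 0 ≤ t ∧ F t ≤ ε) => ht.1⟩
        (show r * sInf {t : ℝ | 0 ≤ t ∧ F t ≤ ε} ∈ {t : ℝ | 0 ≤ t ∧ F t ≤ ε} from
          ⟨(mul_pos hr0 hpos_a).le, hlt.le⟩)
      exact (mul_lt_of_lt_one_left hpos_a hr1).not_ge this
    exact div_le_div_of_nonneg_left (hpos _ (mul_pos hy hpos_a)).le hε0 hle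
  · obtain ⟨r, hbr, hr1⟩ :=
      (((hcont.mono_left nhdsWithin_le_nhds).eventually_lt_const hb).and
        (self_mem_nhdsWithin (s := Ioi (1 : ℝ)))).exists
    have hr1 : 1 < r := hr1
    have hr0 : 0 < r := one_pos.trans hr1
    filter_upwards [((hreg r hr0 y hy).comp ha).eventually_lt_const hbr,
      ha.eventually_gt_atTop 0, self_mem_nhdsWithin] with ε hε hpos_a hε0
    have hε0 : 0 < ε := hε0
    refine lt_of_le_of_lt ?_ hε
    have hle : F (r * sInf {t : ℝ | 0 ≤ t ∧ F t ≤ ε}) ≤ ε := by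
      obtain ⟨t, ht0, htε⟩ :=
        ((eventually_ge_atTop 0).and (hlim.eventually_lt_const hε0)).exists
      obtain ⟨s, hs, hsr⟩ := exists_lt_of_csInf_lt
        (s := {t : ℝ | 0 ≤ t ∧ F t ≤ ε}) ⟨t, ht0, htε.le⟩ (lt_mul_of_one_lt_left hpos_a hr1)
      exact (hanti hsr.le).trans hs.2
    exact div_le_div_of_nonneg_left (hpos _ (mul_pos hy hpos_a)).le
      (hpos _ (mul_pos hr0 hpos_a)) hle

/-- Lemma 3.4 (Lemma A'): for every `y > 0`, `(1/ε)·F̄(y/c_ε) → y^{-α}` as `ε → 0⁺`. -/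
theorem one_div_eps_tail_at_y_div_c_tendsto
    {Ω : Type*} [MeasurableSpace Ω] (P : Measure Ω) [IsProbabilityMeasure P]
    (τ : Ω → ℝ) (hτ : Measurable τ)
    (α : ℝ) (hα0 : 0 < α) (hα1 : α < 1)
    (L : ℝ → ℝ) (hLpos : ∀ t > (0 : ℝ), 0 < L t)
    (hLslow : ∀ lam > (0 : ℝ), Tendsto (fun t => L (lam * t) / L t) atTop (𝓝 1))
    (hpos : P {ω | 0 < τ ω} = 1)
    (Fbar : ℝ → ℝ) (hFbar : ∀ t, Fbar t = (P {ω | t < τ ω}).toReal)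
    (htail : ∀ t > (0 : ℝ), Fbar t = L t / t ^ α)
    (c : ℝ → ℝ) (hc : ∀ ε, c ε = (sInf {t : ℝ | 0 ≤ t ∧ Fbar t ≤ ε})⁻¹)
    :
    ∀ y > (0 : ℝ),
      Tendsto (fun ε => (1 / ε) * Fbar (y / c ε)) (𝓝[>] (0 : ℝ)) (𝓝 (y ^ (-α))) := by
  intro y hy
  have hF : Fbar = fun t => (P {ω | t < τ ω}).toReal := funext hFbar
  have hanti : Antitone Fbar := by
    intro s t hst
    rw [hFbar, hFbar]
    exact ENNReal.toReal_mono (measure_ne_top _ _)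
      (measure_mono fun ω (hω : t < τ ω) => lt_of_le_of_lt hst hω)
  have hFpos : ∀ t > (0 : ℝ), 0 < Fbar t := fun t ht => by
    rw [htail t ht]
    exact div_pos (hLpos t ht) (Real.rpow_pos_of_pos ht α)
  have hlim : Tendsto Fbar atTop (𝓝 0) := hF ▸ tendsto_tail_atTop P hτ
  refine (tendsto_comp_generalizedInverse hanti hFpos hlim
    (fun r hr s hs => tendsto_ratio_of_slowlyVarying hLslow htail hr hs) hy).congr fun ε => ?_
  rw [hc, div_inv_eq_mul, one_div_mul_eq_div]

end
end

section
/- With F̄, c_ε, H, G, and the generalized inverse G⁻¹ as below, there exists λ > 0 sufficiently small such that G⁻¹(y) ≤ 1/c_{λ/y^α} for all y ≥ 1 (equivalently, g_ε(x) ≤ c_ε / c_{λε/x^α} for all x ≥ ε^{1/α}). -/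
open MeasureTheory Filter Topology Set

noncomputable section

/-- The tail `P(X > t)` of a real random variable tends to `0` as `t → ∞`. -/
theorem tendsto_measure_lt_atTop_zero {Ω : Type*} [MeasurableSpace Ω] (P : Measure Ω)
    [IsFiniteMeasure P] {X : Ω → ℝ} (hX : Measurable X) :
    Tendsto (fun t : ℝ => (P {ω | t < X ω}).toReal) atTop (𝓝 0) := by
  have hinter : ⋂ t : ℝ, {ω | t < X ω} = ∅ := by
    ext ω
    simp only [mem_iInter, mem_ofPred_eq, mem_empty_iff_false, iff_false, not_forall, not_lt]
    exact ⟨X ω, le_rfl⟩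
  have h := tendsto_measure_iInter_atTop (μ := P) (s := fun t : ℝ => {ω | t < X ω})
    (fun t => (measurableSet_lt measurable_const hX).nullMeasurableSet)
    (fun _ _ hst _ hω => lt_of_le_of_lt hst hω) ⟨0, measure_ne_top P _⟩
  rw [hinter, measure_empty] at h
  exact (ENNReal.tendsto_toReal ENNReal.zero_ne_top).comp h

/-- A positive antitone function asymptotic to `y ^ (-α)` at infinity is bounded below
by a multiple of `y ^ (-α)` on `[1, ∞)`. -/
theorem exists_pos_forall_div_rpow_lt {α : ℝ} (hα : 0 ≤ α) {H : ℝ → ℝ}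
    (hanti : AntitoneOn H (Ici 0)) (hpos : ∀ y ≥ (0 : ℝ), 0 < H y)
    (htail : Tendsto (fun y => y ^ α * H y) atTop (𝓝 1)) :
    ∃ lam > (0 : ℝ), ∀ y ≥ (1 : ℝ), lam / y ^ α < H y := by
  obtain ⟨M, hM⟩ := eventually_atTop.1 (htail.eventually_const_lt (one_half_lt_one (α := ℝ)))
  have hN : 0 < H (max M 0) := hpos _ (le_max_right _ _)
  refine ⟨min (1 / 2) (H (max M 0) / 2), by positivity, fun y hy => ?_⟩
  have hy0 : 0 < y := one_pos.trans_le hy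
  have hyα : 1 ≤ y ^ α := Real.one_le_rpow hy hα
  rw [div_lt_iff₀' (by positivity)]
  rcases le_total (max M 0) y with h | h
  · exact (min_le_left _ _).trans_lt (hM y ((le_max_left _ _).trans h))
  · calc min (1 / 2) (H (max M 0) / 2) ≤ H (max M 0) / 2 := min_le_right _ _
      _ < H (max M 0) := half_lt_self hN
      _ ≤ H y := hanti (mem_Ici.2 hy0.le) (mem_Ici.2 (le_max_right _ _)) h
      _ ≤ y ^ α * H y := le_mul_of_one_le_left (hpos y hy0.le).le hyα

/-- Lemma 3.6 (Lemma C): there exists `λ > 0` small enough such that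
`G⁻¹(y) ≤ 1/c_{λ/y^α}` for all `y ≥ 1`. -/
theorem exists_lambda_Ginv_le_inv_c
    {Ω : Type*} [MeasurableSpace Ω] (P : Measure Ω) [IsProbabilityMeasure P]
    (τ : Ω → ℝ) (hτ : Measurable τ)
    (α : ℝ) (hα0 : 0 < α) (hα1 : α < 1)
    (L : ℝ → ℝ) (hLpos : ∀ t > (0 : ℝ), 0 < L t)
    (hLslow : ∀ lam > (0 : ℝ), Tendsto (fun t => L (lam * t) / L t) atTop (𝓝 1))
    (hpos : P {ω | 0 < τ ω} = 1)
    (Fbar : ℝ → ℝ) (hFbar : ∀ t, Fbar t = (P {ω | t < τ ω}).toReal)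
    (htail : ∀ t > (0 : ℝ), Fbar t = L t / t ^ α)
    (c : ℝ → ℝ) (hc : ∀ ε, c ε = (sInf {t : ℝ | 0 ≤ t ∧ Fbar t ≤ ε})⁻¹)
    (H : ℝ → ℝ) (hH0 : H 0 = 1) (hHcont : ContinuousOn H (Ici 0))
    (hHanti : StrictAntiOn H (Ici 0))
    (hHpos : ∀ y ≥ (0 : ℝ), 0 < H y) (hHle : ∀ y ≥ (0 : ℝ), H y ≤ 1)
    (hHlim : Tendsto H atTop (𝓝 0))
    (hHtail : Tendsto (fun y => y ^ α * H y) atTop (𝓝 1))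
    (G : ℝ → ℝ) (hGnn : ∀ x ≥ (0 : ℝ), 0 ≤ G x)
    (hHG : ∀ x ≥ (0 : ℝ), H (G x) = Fbar x)
    (Ginv : ℝ → ℝ) (hGinv : ∀ y, Ginv y = sInf {x : ℝ | 0 ≤ x ∧ y < G x})
    (g : ℝ → ℝ → ℝ)
    (hg : ∀ ε > (0 : ℝ), ∀ x, g ε x = c ε * Ginv (ε ^ (-(1 / α)) * x))
    :
    ∃ lam > (0 : ℝ), ∀ y ≥ (1 : ℝ), Ginv y ≤ (c (lam / y ^ α))⁻¹ := by
  obtain ⟨lam, hlam, hlt⟩ :=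
    exists_pos_forall_div_rpow_lt hα0.le hHanti.antitoneOn hHpos hHtail
  refine ⟨lam, hlam, fun y hy => ?_⟩
  have hy0 : 0 < y := one_pos.trans_le hy
  have hFlim : Tendsto Fbar atTop (𝓝 0) := by
    simpa only [← hFbar] using tendsto_measure_lt_atTop_zero P hτ
  have hne : {t : ℝ | 0 ≤ t ∧ Fbar t ≤ lam / y ^ α}.Nonempty :=
    ((eventually_ge_atTop 0).and (hFlim.eventually_le_const (by positivity))).exists
  rw [hc, inv_inv, hGinv]
  refine le_csInf hne fun t ht => csInf_le ⟨0, fun x hx => hx.1⟩ ⟨ht.1, ?_⟩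
  refine (hHanti.lt_iff_gt (hGnn t ht.1) hy0.le).1 ?_
  rw [hHG t ht.1]
  exact ht.2.trans_lt (hlt y hy)

end
end

section
/- (Main Lemma 1) With F̄, c_ε, H, G, G⁻¹ and g_ε as below, for every fixed y > 0 one has g_ε(y) → y as ε → 0⁺. -/
open MeasureTheory Filter Topology Set

noncomputable section

/-- A function with tail `L t / t ^ α`, `L` slowly varying, is regularly varying of index `-α`. -/
lemma tendsto_div_of_slowly_varying {α : ℝ} {L F : ℝ → ℝ} (hLpos : ∀ t > (0 : ℝ), 0 < L t)
    (hLslow : ∀ lam > (0 : ℝ), Tendsto (fun t => L (lam * t) / L t) atTop (𝓝 1))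
    (hF : ∀ t > (0 : ℝ), F t = L t / t ^ α) {r s : ℝ} (hr : 0 < r) (hs : 0 < s) :
    Tendsto (fun t => F (r * t) / F (s * t)) atTop (𝓝 ((r / s) ^ (-α))) := by
  have h := ((hLslow r hr).div (hLslow s hs) one_ne_zero).mul_const ((r / s) ^ (-α))
  rw [div_one, one_mul] at h
  refine h.congr' ?_
  filter_upwards [eventually_gt_atTop 0] with t ht
  have hrt := mul_pos hr ht
  have hst := mul_pos hs ht
  have hLt := hLpos t ht
  have hLs := hLpos _ hst
  have hrα := Real.rpow_pos_of_pos hr α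
  have hsα := Real.rpow_pos_of_pos hs α
  have htα := Real.rpow_pos_of_pos ht α
  rw [Pi.div_apply, hF _ hrt, hF _ hst, Real.mul_rpow hr.le ht.le, Real.mul_rpow hs.le ht.le,
    Real.rpow_neg (div_pos hr hs).le, Real.div_rpow hr.le hs.le]
  field_simp

/-- A nonnegative antitone function that is regularly varying of negative index tends to `0`. -/
lemma Antitone.tendsto_zero_of_regularly_varying {α : ℝ} {F : ℝ → ℝ} (hα : 0 < α)
    (hF : Antitone F) (hFnn : ∀ t, 0 ≤ F t)
    (hreg : Tendsto (fun t => F (2 * t) / F t) atTop (𝓝 (2 ^ (-α)))) :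
    Tendsto F atTop (𝓝 0) := by
  have hlim := tendsto_atTop_ciInf hF ⟨0, by rintro _ ⟨t, rfl⟩; exact hFnn t⟩
  by_cases h0 : (⨅ t, F t) = 0
  · rwa [h0] at hlim
  have h2 : Tendsto (fun t : ℝ => 2 * t) atTop atTop := tendsto_id.const_mul_atTop two_pos
  have h1 := (hlim.comp h2).div hlim h0
  rw [div_self h0] at h1
  have heq := tendsto_nhds_unique hreg h1
  exact absurd heq (Real.rpow_lt_one_of_one_lt_of_neg one_lt_two (neg_lt_zero.2 hα)).ne

/-- Main Lemma 1: for every fixed `y > 0`, `g_ε(y) → y` as `ε → 0⁺`. -/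
theorem g_eps_tendsto_id
    {Ω : Type*} [MeasurableSpace Ω] (P : Measure Ω) [IsProbabilityMeasure P]
    (τ : Ω → ℝ) (hτ : Measurable τ)
    (α : ℝ) (hα0 : 0 < α) (hα1 : α < 1)
    (L : ℝ → ℝ) (hLpos : ∀ t > (0 : ℝ), 0 < L t)
    (hLslow : ∀ lam > (0 : ℝ), Tendsto (fun t => L (lam * t) / L t) atTop (𝓝 1))
    (hpos : P {ω | 0 < τ ω} = 1)
    (Fbar : ℝ → ℝ) (hFbar : ∀ t, Fbar t = (P {ω | t < τ ω}).toReal)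
    (htail : ∀ t > (0 : ℝ), Fbar t = L t / t ^ α)
    (c : ℝ → ℝ) (hc : ∀ ε, c ε = (sInf {t : ℝ | 0 ≤ t ∧ Fbar t ≤ ε})⁻¹)
    (H : ℝ → ℝ) (hH0 : H 0 = 1) (hHcont : ContinuousOn H (Ici 0))
    (hHanti : StrictAntiOn H (Ici 0))
    (hHpos : ∀ y ≥ (0 : ℝ), 0 < H y) (hHle : ∀ y ≥ (0 : ℝ), H y ≤ 1)
    (hHlim : Tendsto H atTop (𝓝 0))
    (hHtail : Tendsto (fun y => y ^ α * H y) atTop (𝓝 1))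
    (G : ℝ → ℝ) (hGnn : ∀ x ≥ (0 : ℝ), 0 ≤ G x)
    (hHG : ∀ x ≥ (0 : ℝ), H (G x) = Fbar x)
    (Ginv : ℝ → ℝ) (hGinv : ∀ y, Ginv y = sInf {x : ℝ | 0 ≤ x ∧ y < G x})
    (g : ℝ → ℝ → ℝ)
    (hg : ∀ ε > (0 : ℝ), ∀ x, g ε x = c ε * Ginv (ε ^ (-(1 / α)) * x))
    :
    ∀ y > (0 : ℝ), Tendsto (fun ε => g ε y) (𝓝[>] (0 : ℝ)) (𝓝 y) := by
  intro y hy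
  have hanti : Antitone Fbar := fun s t hst => by
    rw [hFbar, hFbar]
    exact measureReal_mono (fun ω (hω : t < τ ω) => hst.trans_lt hω)
  have hFnn : ∀ t, 0 ≤ Fbar t := fun t => by rw [hFbar]; exact ENNReal.toReal_nonneg
  have hFpos : ∀ t > (0 : ℝ), 0 < Fbar t := fun t ht => by
    rw [htail t ht]
    exact div_pos (hLpos t ht) (Real.rpow_pos_of_pos ht α)
  have hreg : ∀ r > (0 : ℝ), ∀ s > (0 : ℝ),
      Tendsto (fun t => Fbar (r * t) / Fbar (s * t)) atTop (𝓝 ((r / s) ^ (-α))) :=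
    fun r hr s hs => tendsto_div_of_slowly_varying hLpos hLslow htail hr hs
  have hF0 : Tendsto Fbar atTop (𝓝 0) :=
    hanti.tendsto_zero_of_regularly_varying hα0 hFnn (by simpa using hreg 2 two_pos 1 one_pos)
  set a : ℝ → ℝ := fun ε => sInf {t : ℝ | 0 ≤ t ∧ Fbar t ≤ ε} with ha
  have hne : ∀ ε > (0 : ℝ), {t : ℝ | 0 ≤ t ∧ Fbar t ≤ ε}.Nonempty := fun ε hε =>
    ((eventually_ge_atTop 0).and (hF0.eventually_le_const hε)).exists
  have hbdd : ∀ p : ℝ → Prop, BddBelow {t : ℝ | 0 ≤ t ∧ p t} := fun p => ⟨0, fun t ht => ht.1⟩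
  have ha_top : Tendsto a (𝓝[>] 0) atTop := by
    refine tendsto_atTop.2 fun T => ?_
    have hT : 0 < max T 1 := lt_max_of_lt_right one_pos
    filter_upwards [self_mem_nhdsWithin,
      mem_nhdsWithin_of_mem_nhds (Iio_mem_nhds (hFpos _ hT))] with ε hε hεT
    refine le_csInf (hne ε hε) fun t ht => ?_
    by_contra! hlt
    exact (hanti (hlt.le.trans (le_max_left T 1))).not_gt (ht.2.trans_lt hεT)
  have ha_le : ∀ ε > (0 : ℝ), ∀ t, a ε < t → Fbar t ≤ ε := fun ε hε t ht => by
    obtain ⟨s, hs, hst⟩ := exists_lt_of_csInf_lt (hne ε hε) ht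
    exact (hanti hst.le).trans hs.2
  have ha_gt : ∀ ε, ∀ t ≥ (0 : ℝ), t < a ε → ε < Fbar t := fun ε t ht hta => by
    by_contra! h
    exact (csInf_le (hbdd _) ⟨ht, h⟩).not_gt hta
  set z : ℝ → ℝ := fun ε => ε ^ (-(1 / α)) * y with hz
  have hz_top : Tendsto z (𝓝[>] 0) atTop := by
    refine Tendsto.atTop_mul_const hy ?_
    exact tendsto_rpow_neg_nhdsGT_zero (by simpa using hα0)
  have hHz : Tendsto (fun ε => H (z ε) / ε) (𝓝[>] 0) (𝓝 (y ^ (-α))) := by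
    have h := (hHtail.comp hz_top).mul_const (y ^ (-α))
    rw [one_mul] at h
    refine h.congr' ?_
    filter_upwards [self_mem_nhdsWithin] with ε (hε : 0 < ε)
    have hyα := Real.rpow_pos_of_pos hy α
    simp only [Function.comp_apply]
    have hzα : z ε ^ α = ε⁻¹ * y ^ α := by
      rw [hz, Real.mul_rpow (Real.rpow_nonneg hε.le _) hy.le, ← Real.rpow_mul hε.le,
        neg_mul, one_div_mul_cancel hα0.ne', Real.rpow_neg_one]
    rw [hzα, Real.rpow_neg hy.le]
    field_simp
  have hlt_iff : ∀ ε > (0 : ℝ), ∀ x ≥ (0 : ℝ), z ε < G x ↔ Fbar x < H (z ε) :=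
    fun ε hε x hx => by
      rw [← hHG x hx]
      exact (hHanti.lt_iff_gt (hGnn x hx) (mul_pos (Real.rpow_pos_of_pos hε _) hy).le).symm
  have hratio : ∀ r > (0 : ℝ), ∀ s > (0 : ℝ),
      Tendsto (fun ε => Fbar (r * a ε) / Fbar (s * a ε)) (𝓝[>] 0) (𝓝 ((r / s) ^ (-α))) :=
    fun r hr s hs => (hreg r hr s hs).comp ha_top
  have hupper : ∀ r > y, ∀ᶠ ε in 𝓝[>] (0 : ℝ), Fbar (r * a ε) < H (z ε) := fun r hr => by
    have hr0 := hy.trans hr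
    obtain ⟨s, hs1, hs⟩ := exists_between ((one_lt_div hy).2 hr)
    have hs0 := one_pos.trans hs1
    have hys : y < r / s := by rw [lt_div_iff₀ hs0]; rw [lt_div_iff₀ hy] at hs; linarith
    filter_upwards [self_mem_nhdsWithin, ha_top.eventually_gt_atTop 0,
      (hratio r hr0 s hs0).eventually_lt hHz
        (Real.rpow_lt_rpow_of_neg hy hys (neg_lt_zero.2 hα0))] with ε (hε : 0 < ε) haε h
    rw [div_lt_div_iff₀ (hFpos _ (mul_pos hs0 haε)) hε] at h
    have h1 := ha_le ε hε (s * a ε) (lt_mul_of_one_lt_left haε hs1)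
    have hH := hHpos (z ε) (mul_pos (Real.rpow_pos_of_pos hε _) hy).le
    exact lt_of_mul_lt_mul_right (h.trans_le (mul_le_mul_of_nonneg_left h1 hH.le)) hε.le
  have hlower : ∀ r > (0 : ℝ), r < y → ∀ᶠ ε in 𝓝[>] (0 : ℝ), H (z ε) < Fbar (r * a ε) :=
    fun r hr0 hr => by
      obtain ⟨s, hs, hs1⟩ := exists_between ((div_lt_one hy).2 hr)
      have hs0 := (div_pos hr0 hy).trans hs
      have hys : r / s < y := by rw [div_lt_iff₀ hs0]; rw [div_lt_iff₀ hy] at hs; linarith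
      filter_upwards [self_mem_nhdsWithin, ha_top.eventually_gt_atTop 0,
        hHz.eventually_lt (hratio r hr0 s hs0)
          (Real.rpow_lt_rpow_of_neg (div_pos hr0 hs0) hys (neg_lt_zero.2 hα0))]
        with ε (hε : 0 < ε) haε h
      rw [div_lt_div_iff₀ hε (hFpos _ (mul_pos hs0 haε))] at h
      have h1 := ha_gt ε (s * a ε) (mul_pos hs0 haε).le (mul_lt_of_lt_one_left haε hs1)
      have hH := hHpos (z ε) (mul_pos (Real.rpow_pos_of_pos hε _) hy).le
      exact lt_of_mul_lt_mul_right ((mul_le_mul_of_nonneg_left h1.le hH.le).trans_lt h) hε.le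
  have hgz : ∀ ε > (0 : ℝ), g ε y = sInf {x : ℝ | 0 ≤ x ∧ z ε < G x} / a ε := fun ε hε => by
    rw [hg ε hε, hc, hGinv]
    exact (div_eq_inv_mul _ _).symm
  refine tendsto_order.2 ⟨fun b hb => ?_, fun b hb => ?_⟩
  · obtain ⟨r, hbr, hry⟩ := exists_between (max_lt hb hy)
    have hr0 := (le_max_right b 0).trans_lt hbr
    filter_upwards [self_mem_nhdsWithin, ha_top.eventually_gt_atTop 0, hlower r hr0 hry,
      hupper (y + 1) (lt_add_one y)] with ε (hε : 0 < ε) haε hlo hup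
    have hmem : 0 ≤ (y + 1) * a ε := (mul_pos (by linarith) haε).le
    rw [hgz ε hε]
    refine ((le_max_left b 0).trans_lt hbr).trans_le ((le_div_iff₀ haε).2 ?_)
    refine le_csInf ⟨_, hmem, (hlt_iff ε hε _ hmem).2 hup⟩ fun x hx => ?_
    by_contra! hlt
    exact (hanti hlt.le).not_gt (((hlt_iff ε hε x hx.1).1 hx.2).trans hlo)
  · obtain ⟨r, hyr, hrb⟩ := exists_between hb
    filter_upwards [self_mem_nhdsWithin, ha_top.eventually_gt_atTop 0, hupper r hyr]
      with ε (hε : 0 < ε) haε hup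
    have hmem : 0 ≤ r * a ε := (mul_pos (hy.trans hyr) haε).le
    rw [hgz ε hε]
    refine ((div_le_iff₀ haε).2 ?_).trans_lt hrb
    exact csInf_le (hbdd _) ⟨hmem, (hlt_iff ε hε _ hmem).2 hup⟩

end
end

section
/- (Main Lemma 2) With F̄, c_ε, H, G, G⁻¹ and g_ε as below, for every δ' > 0 there exist constants C' ∈ (0,∞) and C'' ∈ (0,∞) such that g_ε(x) ≤ C'·x^{1-δ'} whenever ε^{1/α} ≤ x ≤ 1 and 0 < ε ≤ C''. -/
open MeasureTheory Filter Topology Set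

noncomputable section

/-- A tail `t ^ (-α) * L t` with `L` slowly varying is regularly varying of index `-α`. -/
theorem tendsto_tail_ratio {F L : ℝ → ℝ} {α : ℝ} (hLpos : ∀ t > (0 : ℝ), 0 < L t)
    (hLslow : ∀ lam > (0 : ℝ), Tendsto (fun t => L (lam * t) / L t) atTop (𝓝 1))
    (htail : ∀ t > (0 : ℝ), F t = L t / t ^ α) {m : ℝ} (hm : 0 < m) :
    Tendsto (fun t => F (m * t) / F t) atTop (𝓝 (m ^ (-α))) := by
  have h := (hLslow m hm).mul_const (m ^ (-α))
  rw [one_mul] at h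
  refine h.congr' ?_
  filter_upwards [eventually_gt_atTop 0] with t ht
  rw [htail t ht, htail _ (mul_pos hm ht), Real.mul_rpow hm.le ht.le, Real.rpow_neg hm.le]
  have := hLpos t ht
  have := Real.rpow_pos_of_pos hm α
  have := Real.rpow_pos_of_pos ht α
  field_simp

/-- Potter-type bound: a nonincreasing function that loses at most a factor `2 ^ (-p)` under
doubling of the argument decays at most like `t ^ (-p)`. -/
theorem le_mul_rpow_of_doubling {F : ℝ → ℝ} (hF : Antitone F) {p s₀ : ℝ} (hp : 0 < p)
    (hs₀ : 0 < s₀) (hpos : ∀ t > (0 : ℝ), 0 < F t)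
    (hdouble : ∀ t ≥ s₀, F t ≤ 2 ^ p * F (2 * t)) {s t : ℝ} (hs : s₀ ≤ s) (hst : s ≤ t) :
    F s ≤ 2 ^ p * (t / s) ^ p * F t := by
  have hspos : 0 < s := hs₀.trans_le hs
  have htpos : 0 < t := hspos.trans_le hst
  have iter : ∀ n : ℕ, F s ≤ ((2 : ℝ) ^ n) ^ p * F (2 ^ n * s) := by
    intro n
    induction n with
    | zero => simp
    | succ n ih =>
      have h1 : s₀ ≤ 2 ^ n * s :=
        hs.trans (le_mul_of_one_le_left hspos.le (one_le_pow₀ one_le_two))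
      calc F s ≤ ((2 : ℝ) ^ n) ^ p * F (2 ^ n * s) := ih
        _ ≤ ((2 : ℝ) ^ n) ^ p * (2 ^ p * F (2 * (2 ^ n * s))) := by
          gcongr
          exact hdouble _ h1
        _ = ((2 : ℝ) ^ (n + 1)) ^ p * F (2 ^ (n + 1) * s) := by
          rw [pow_succ, Real.mul_rpow (by positivity) (by norm_num)]
          ring_nf
  obtain ⟨n, hn, hn'⟩ := exists_nat_pow_near ((one_le_div hspos).2 hst) one_lt_two
  have h2 : t ≤ 2 ^ (n + 1) * s := ((div_lt_iff₀ hspos).1 hn').le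
  calc F s ≤ ((2 : ℝ) ^ (n + 1)) ^ p * F (2 ^ (n + 1) * s) := iter _
    _ ≤ ((2 : ℝ) ^ (n + 1)) ^ p * F t := by gcongr; exact hF h2
    _ = 2 ^ p * ((2 : ℝ) ^ n) ^ p * F t := by
      rw [pow_succ, Real.mul_rpow (by positivity) (by norm_num)]
      ring
    _ ≤ 2 ^ p * (t / s) ^ p * F t := by
      have := (hpos t htpos).le
      gcongr

/-- A positive nonincreasing function asymptotic to `y ^ (-α)` dominates a multiple of it on
`[1, ∞)`. -/
theorem exists_mul_rpow_neg_le {H : ℝ → ℝ} {α : ℝ} (hα : 0 < α)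
    (hH : AntitoneOn H (Ici 0)) (hpos : ∀ y ≥ (0 : ℝ), 0 < H y)
    (htail : Tendsto (fun y => y ^ α * H y) atTop (𝓝 1)) :
    ∃ k > (0 : ℝ), ∀ y ≥ (1 : ℝ), k * y ^ (-α) ≤ H y := by
  obtain ⟨y₀, hy₀⟩ := eventually_atTop.1 (htail.eventually (lt_mem_nhds one_half_lt_one))
  set y₁ := max y₀ 0
  have hy₁ : 0 < H y₁ := hpos _ (le_max_right _ _)
  refine ⟨min (1 / 2) (H y₁), by positivity, fun y hy => ?_⟩
  have hy0 : 0 < y := one_pos.trans_le hy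
  have hyα : 0 < y ^ α := Real.rpow_pos_of_pos hy0 α
  rw [Real.rpow_neg hy0.le, ← div_eq_mul_inv, div_le_iff₀ hyα]
  rcases le_total y₁ y with h | h
  · have := hy₀ y ((le_max_left _ _).trans h)
    rw [mul_comm]
    exact (min_le_left _ _).trans this.le
  · calc min (1 / 2) (H y₁) ≤ H y₁ := min_le_right _ _
      _ ≤ H y := hH hy0.le (mem_Ici.2 (le_max_right _ _)) h
      _ ≤ H y * y ^ α :=
        le_mul_of_one_le_right (hpos y hy0.le).le (Real.one_le_rpow hy hα.le)

/-- Scaling estimate: if `F` is regularly varying of index `-α` and `F b ≤ ε`, then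
`F (M * x ^ (1 - δ) * b)` is smaller than `k * ε * x ^ (-α)` for `M` large and `ε` small. -/
theorem exists_tail_lt {F L : ℝ → ℝ} {α k δ : ℝ} (hF : Antitone F) (hα : 0 < α)
    (hLpos : ∀ t > (0 : ℝ), 0 < L t)
    (hLslow : ∀ lam > (0 : ℝ), Tendsto (fun t => L (lam * t) / L t) atTop (𝓝 1))
    (htail : ∀ t > (0 : ℝ), F t = L t / t ^ α) (hk : 0 < k) (hδ : 0 < δ) (hδ1 : δ < 1) :
    ∃ M > (0 : ℝ), ∃ ε₀ > (0 : ℝ), ∀ ε b x : ℝ, 0 < ε → ε ≤ ε₀ → F b ≤ ε →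
      ε ^ (1 / α) ≤ x → x ≤ 1 → F (M * (x ^ (1 - δ) * b)) < k * ε * x ^ (-α) := by
  have hFpos : ∀ t > (0 : ℝ), 0 < F t := fun t ht => by
    rw [htail t ht]
    exact div_pos (hLpos t ht) (Real.rpow_pos_of_pos ht α)
  set p := α * (1 + δ) with hp_def
  have hp : 0 < p := by positivity
  have hpα : α < p := by nlinarith
  set K : ℝ := 2 ^ p with hK_def
  have hK : 0 < K := by positivity
  set M : ℝ := (4 * K / k) ^ (1 / α) with hM_def
  have hM : 0 < M := by positivity
  have hMα : M ^ (-α) = k / (4 * K) := by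
    rw [hM_def, ← Real.rpow_mul (by positivity),
      show 1 / α * -α = -1 by field_simp, Real.rpow_neg_one, inv_div]
  have ev1 : ∀ᶠ t in atTop, F t ≤ 2 ^ p * F (2 * t) := by
    have hlt : (2 : ℝ) ^ (-p) < 2 ^ (-α) :=
      Real.rpow_lt_rpow_of_exponent_lt one_lt_two (neg_lt_neg hpα)
    filter_upwards [(tendsto_tail_ratio hLpos hLslow htail two_pos).eventually
      (lt_mem_nhds hlt), eventually_gt_atTop 0] with t ht ht0
    rw [lt_div_iff₀ (hFpos t ht0), Real.rpow_neg two_pos.le, inv_mul_lt_iff₀ hK] at ht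
    exact ht.le
  have ev2 : ∀ᶠ t in atTop, F (M * t) < 2 * M ^ (-α) * F t := by
    have hMp : 0 < M ^ (-α) := Real.rpow_pos_of_pos hM _
    filter_upwards [(tendsto_tail_ratio hLpos hLslow htail hM).eventually
      (gt_mem_nhds (show M ^ (-α) < 2 * M ^ (-α) by linarith)), eventually_gt_atTop 0]
      with t ht ht0
    rwa [div_lt_iff₀ (hFpos t ht0)] at ht
  obtain ⟨s₀, hs₀⟩ := eventually_atTop.1 (ev1.and (ev2.and (eventually_gt_atTop 0)))
  have hs₀pos : 0 < s₀ := (hs₀ s₀ le_rfl).2.2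
  have potter := fun s t (h : s₀ ≤ s) (h' : s ≤ t) =>
    le_mul_rpow_of_doubling hF hp hs₀pos hFpos (fun t ht => (hs₀ t ht).1) h h'
  have hFs₀ := hFpos s₀ hs₀pos
  refine ⟨M, hM, min (F s₀ / 2) ((F s₀ / K) ^ (1 / δ ^ 2)), by positivity, ?_⟩
  intro ε b x hε hε₀ hb hεx hx1
  have hx : 0 < x := (Real.rpow_pos_of_pos hε _).trans_le hεx
  have hsb : s₀ ≤ b := by
    by_contra! h
    have h1 := hF h.le
    have h2 := hε₀.trans (min_le_left _ _)
    linarith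
  have hb0 : 0 < b := hs₀pos.trans_le hsb
  set v := x ^ (1 - δ) with hv_def
  have hv : 0 < v := Real.rpow_pos_of_pos hx _
  have hv1 : v ≤ 1 := Real.rpow_le_one hx.le hx1 (by linarith)
  have hεv : ε ^ (1 - δ ^ 2) ≤ v ^ p := by
    have h1 : (ε ^ (1 / α)) ^ ((1 - δ) * p) ≤ x ^ ((1 - δ) * p) :=
      Real.rpow_le_rpow (by positivity) hεx (mul_nonneg (by linarith) hp.le)
    rw [← Real.rpow_mul hε.le] at h1
    rw [hv_def, ← Real.rpow_mul hx.le]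
    refine le_of_eq_of_le ?_ h1
    congr 1
    rw [hp_def]
    field_simp
    ring
  have hεδ : K * ε ^ (δ ^ 2) ≤ F s₀ := by
    have h1 : ε ^ (δ ^ 2) ≤ ((F s₀ / K) ^ (1 / δ ^ 2)) ^ (δ ^ 2) :=
      Real.rpow_le_rpow hε.le (hε₀.trans (min_le_right _ _)) (by positivity)
    rw [← Real.rpow_mul (by positivity), one_div_mul_cancel (by positivity),
      Real.rpow_one, le_div_iff₀ hK] at h1
    linarith
  have hsv : s₀ ≤ v * b := by
    have h1 : F s₀ ≤ K * (b / s₀) ^ p * ε :=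
      (potter s₀ b le_rfl hsb).trans (by gcongr)
    have h2 : ε ^ (δ ^ 2) ≤ (b / s₀) ^ p * ε := by
      have h3 := hεδ.trans h1
      rw [mul_assoc] at h3
      exact le_of_mul_le_mul_left h3 hK
    have h4 : 1 ≤ (v * b / s₀) ^ p := by
      have h5 : ε ≤ (v * b / s₀) ^ p * ε := by
        calc ε = ε ^ (1 - δ ^ 2) * ε ^ (δ ^ 2) := by
              rw [← Real.rpow_add hε, sub_add_cancel, Real.rpow_one]
          _ ≤ v ^ p * ((b / s₀) ^ p * ε) := by gcongr
          _ = (v * b / s₀) ^ p * ε := by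
            rw [mul_div_assoc, Real.mul_rpow hv.le (by positivity), mul_assoc]
      exact le_of_mul_le_mul_right (by linarith) hε
    rw [← one_le_div hs₀pos]
    by_contra! h
    exact absurd h4 (not_le.2 (Real.rpow_lt_one (by positivity) h hp))
  have hvx : (v⁻¹) ^ p ≤ x ^ (-α) := by
    rw [hv_def, ← Real.rpow_neg hx.le, ← Real.rpow_mul hx.le]
    refine Real.rpow_le_rpow_of_exponent_ge hx hx1 ?_
    rw [hp_def]
    nlinarith [mul_pos hα (pow_pos hδ 2)]
  have hpb : F (v * b) ≤ K * x ^ (-α) * ε := by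
    calc F (v * b) ≤ K * (b / (v * b)) ^ p * F b :=
          potter _ _ hsv (mul_le_of_le_one_left hb0.le hv1)
      _ = K * (v⁻¹) ^ p * F b := by
        rw [show b / (v * b) = v⁻¹ by field_simp]
      _ ≤ K * x ^ (-α) * ε := by gcongr; exact (hFpos b hb0).le
  calc F (M * (v * b)) < 2 * M ^ (-α) * F (v * b) := (hs₀ _ hsv).2.1
    _ ≤ 2 * M ^ (-α) * (K * x ^ (-α) * ε) := by gcongr
    _ = k * ε * x ^ (-α) / 2 := by
      rw [hMα]
      field_simp
      ring
    _ ≤ k * ε * x ^ (-α) := half_le_self (by positivity)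

/-- Main Lemma 2: for every `δ' > 0` there are constants `C', C'' ∈ (0,∞)`
with `g_ε(x) ≤ C'·x^{1-δ'}` whenever `ε^{1/α} ≤ x ≤ 1` and `0 < ε ≤ C''`. -/
theorem g_eps_power_bound
    {Ω : Type*} [MeasurableSpace Ω] (P : Measure Ω) [IsProbabilityMeasure P]
    (τ : Ω → ℝ) (hτ : Measurable τ)
    (α : ℝ) (hα0 : 0 < α) (hα1 : α < 1)
    (L : ℝ → ℝ) (hLpos : ∀ t > (0 : ℝ), 0 < L t)
    (hLslow : ∀ lam > (0 : ℝ), Tendsto (fun t => L (lam * t) / L t) atTop (𝓝 1))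
    (hpos : P {ω | 0 < τ ω} = 1)
    (Fbar : ℝ → ℝ) (hFbar : ∀ t, Fbar t = (P {ω | t < τ ω}).toReal)
    (htail : ∀ t > (0 : ℝ), Fbar t = L t / t ^ α)
    (c : ℝ → ℝ) (hc : ∀ ε, c ε = (sInf {t : ℝ | 0 ≤ t ∧ Fbar t ≤ ε})⁻¹)
    (H : ℝ → ℝ) (hH0 : H 0 = 1) (hHcont : ContinuousOn H (Ici 0))
    (hHanti : StrictAntiOn H (Ici 0))
    (hHpos : ∀ y ≥ (0 : ℝ), 0 < H y) (hHle : ∀ y ≥ (0 : ℝ), H y ≤ 1)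
    (hHlim : Tendsto H atTop (𝓝 0))
    (hHtail : Tendsto (fun y => y ^ α * H y) atTop (𝓝 1))
    (G : ℝ → ℝ) (hGnn : ∀ x ≥ (0 : ℝ), 0 ≤ G x)
    (hHG : ∀ x ≥ (0 : ℝ), H (G x) = Fbar x)
    (Ginv : ℝ → ℝ) (hGinv : ∀ y, Ginv y = sInf {x : ℝ | 0 ≤ x ∧ y < G x})
    (g : ℝ → ℝ → ℝ)
    (hg : ∀ ε > (0 : ℝ), ∀ x, g ε x = c ε * Ginv (ε ^ (-(1 / α)) * x))
    :
    ∀ δ' > (0 : ℝ), ∃ C' > (0 : ℝ), ∃ C'' > (0 : ℝ),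
      ∀ ε : ℝ, 0 < ε → ε ≤ C'' →
        ∀ x : ℝ, ε ^ (1 / α) ≤ x → x ≤ 1 → g ε x ≤ C' * x ^ (1 - δ') := by
  intro δ' hδ'
  have hF : Antitone Fbar := by
    intro s t hst
    rw [hFbar, hFbar]
    exact ENNReal.toReal_mono (measure_ne_top P _) (measure_mono fun ω hω => hst.trans_lt hω)
  obtain ⟨k, hk, hkH⟩ := exists_mul_rpow_neg_le hα0 hHanti.antitoneOn hHpos hHtail
  set δ := min δ' (1 / 2)
  have hδ : 0 < δ := by positivity
  have hδ1 : δ < 1 := (min_le_right _ _).trans_lt one_half_lt_one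
  obtain ⟨M, hM, ε₀, hε₀, key⟩ := exists_tail_lt hF hα0 hLpos hLslow htail hk hδ hδ1
  refine ⟨2 * M, by positivity, ε₀, hε₀, fun ε hε hεε₀ x hεx hx1 => ?_⟩
  have hx : 0 < x := (Real.rpow_pos_of_pos hε _).trans_le hεx
  have hxx : x ^ (1 - δ) ≤ x ^ (1 - δ') :=
    Real.rpow_le_rpow_of_exponent_ge hx hx1 (sub_le_sub_left (min_le_left _ _) 1)
  rw [hg ε hε, hc]
  set S := {t : ℝ | 0 ≤ t ∧ Fbar t ≤ ε}
  have ha : 0 ≤ sInf S := Real.sInf_nonneg fun t ht => ht.1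
  rcases ha.eq_or_lt with ha0 | ha0
  · rw [← ha0, inv_zero, zero_mul]
    positivity
  have hSne : S.Nonempty := by
    by_contra h
    rw [not_nonempty_iff_eq_empty.1 h, Real.sInf_empty] at ha0
    exact ha0.false
  obtain ⟨t, ht, ht2⟩ := exists_lt_of_csInf_lt hSne (show sInf S < 2 * sInf S by linarith)
  have hz := key ε (2 * sInf S) x hε hεε₀ ((hF ht2.le).trans ht.2) hεx hx1
  set z := M * (x ^ (1 - δ) * (2 * sInf S)) with hz_def
  have hz0 : 0 ≤ z := by positivity
  set y := ε ^ (-(1 / α)) * x with hy_def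
  have hy1 : 1 ≤ y := by
    rw [hy_def, Real.rpow_neg hε.le, ← div_eq_inv_mul, one_le_div (Real.rpow_pos_of_pos hε _)]
    exact hεx
  have hyα : y ^ (-α) = ε * x ^ (-α) := by
    rw [hy_def, Real.mul_rpow (by positivity) hx.le, ← Real.rpow_mul hε.le,
      show -(1 / α) * -α = 1 by field_simp, Real.rpow_one]
  have hyG : y < G z := by
    by_contra! h
    have h1 := hHanti.antitoneOn (hGnn z hz0) (zero_le_one.trans hy1) h
    have h2 := hkH y hy1
    rw [hyα] at h2
    rw [hHG z hz0] at h1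
    linarith
  have hGz : Ginv y ≤ z := by
    rw [hGinv]
    exact csInf_le ⟨0, fun w hw => hw.1⟩ ⟨hz0, hyG⟩
  calc (sInf S)⁻¹ * Ginv y ≤ (sInf S)⁻¹ * z := by gcongr
    _ = 2 * M * x ^ (1 - δ) := by
      rw [hz_def]
      field_simp
    _ ≤ 2 * M * x ^ (1 - δ') := by gcongr

end
end
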